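/- The metric space (GH_1, d_GH) of isometry classes of compact metric pairs, equipped with the Gromov–Hausdorff distance for metric pairs, is separable. -/

import Mathlib

open Metric Set

/-- An admissible metric on the disjoint union of two metric spaces: a metric on `X ⊕ Y`
restricting to the given metrics on `X` and on `Y`. -/
structure AdmissibleMetric (X Y : Type*) [MetricSpace X] [MetricSpace Y] where
  d : (X ⊕ Y) → (X ⊕ Y) → ℝ
  refl : ∀ p, d p p = 0
  pos : ∀ p q, p ≠ q → 0 < d p q
  symm : ∀ p q, d p q = d q p
  triangle : ∀ p q r, d p r ≤ d p q + d q r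
  restr_left : ∀ x x' : X, d (.inl x) (.inl x') = dist x x'
  restr_right : ∀ y y' : Y, d (.inr y) (.inr y') = dist y y'

/-- Hausdorff distance between two subsets with respect to an abstract distance function. -/
noncomputable def hausdorffDistWrt {Z : Type*} (d : Z → Z → ℝ) (S T : Set Z) : ℝ :=
  max (⨆ s : S, ⨅ t : T, d s t) (⨆ t : T, ⨅ s : S, d s t)

/-- Hausdorff distance between the pairs `(X, A)` and `(Y, B)` inside `X ⊕ Y`,
with respect to a distance function on `X ⊕ Y`:
`d_H^δ((X,A),(Y,B)) = d_H^δ(X,Y) + d_H^δ(A,B)`. -/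
noncomputable def pairHausdorffDistWrt {X Y : Type*} [MetricSpace X] [MetricSpace Y]
    (d : (X ⊕ Y) → (X ⊕ Y) → ℝ) (A : Set X) (B : Set Y) : ℝ :=
  hausdorffDistWrt d (Set.range Sum.inl) (Set.range Sum.inr)
    + hausdorffDistWrt d (Sum.inl '' A) (Sum.inr '' B)

/-- Hausdorff distance between pairs with respect to an admissible metric. -/
noncomputable def pairHausdorffDist {X Y : Type*} [MetricSpace X] [MetricSpace Y]
    (δ : AdmissibleMetric X Y) (A : Set X) (B : Set Y) : ℝ :=
  pairHausdorffDistWrt δ.d A B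

/-- The Gromov–Hausdorff distance between the metric pairs `(X, A)` and `(Y, B)`:
the infimum of the pair Hausdorff distances over all admissible metrics on `X ⊕ Y`. -/
noncomputable def pairGHDist {X Y : Type*} [MetricSpace X] [MetricSpace Y]
    (A : Set X) (B : Set Y) : ℝ :=
  sInf {r | ∃ δ : AdmissibleMetric X Y, r = pairHausdorffDist δ A B}

/-- A pair correspondence between `(X, A)` and `(Y, B)`: a correspondence between `X` and `Y`
whose restriction to `A × B` is a correspondence between `A` and `B`. -/
structure IsPairCorrespondence {X Y : Type*} (R : Set (X × Y)) (A : Set X) (B : Set Y) : Prop where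
  ex_right : ∀ x : X, ∃ y : Y, (x, y) ∈ R
  ex_left : ∀ y : Y, ∃ x : X, (x, y) ∈ R
  ex_right_pair : ∀ a ∈ A, ∃ b ∈ B, (a, b) ∈ R
  ex_left_pair : ∀ b ∈ B, ∃ a ∈ A, (a, b) ∈ R

/-- The distortion of a pair correspondence:
`dis(R) = ½ (sup_{(x,y),(x',y') ∈ R} |d_X(x,x') − d_Y(y,y')|
          + sup_{(a,b),(a',b') ∈ R ∩ A×B} |d_X(a,a') − d_Y(b,b')|)`. -/
noncomputable def pairDistortion {X Y : Type*} [MetricSpace X] [MetricSpace Y]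
    (R : Set (X × Y)) (A : Set X) (B : Set Y) : ℝ :=
  (1 / 2) * ((⨆ p : R, ⨆ q : R, |dist (p : X × Y).1 (q : X × Y).1 - dist (p : X × Y).2 (q : X × Y).2|)
    + (⨆ p : ↥(R ∩ A ×ˢ B), ⨆ q : ↥(R ∩ A ×ˢ B),
        |dist (p : X × Y).1 (q : X × Y).1 - dist (p : X × Y).2 (q : X × Y).2|))

/-- A compact metric pair: a compact metric space together with a nonempty closed subset. -/
structure MetricPair where
  carrier : Type
  [m : MetricSpace carrier]
  [cpt : CompactSpace carrier]
  A : Set carrier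
  hne : A.Nonempty
  hcl : IsClosed A

attribute [instance] MetricPair.m MetricPair.cpt

/-- The Gromov–Hausdorff distance between compact metric pairs. -/
noncomputable def MetricPair.ghDist (P Q : MetricPair) : ℝ :=
  pairGHDist P.A Q.A

lemma hausdorffDistWrt_nonneg {Z : Type*} {d : Z → Z → ℝ} (hd : ∀ p q, 0 ≤ d p q)
    (S T : Set Z) : 0 ≤ hausdorffDistWrt d S T :=
  le_max_of_le_left (Real.iSup_nonneg fun _ => Real.iInf_nonneg fun _ => hd _ _)

lemma hausdorffDistWrt_le {Z : Type*} {d : Z → Z → ℝ} (hd : ∀ p q, 0 ≤ d p q) {S T : Set Z}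
    {r : ℝ} (hr : 0 ≤ r) (hST : ∀ s ∈ S, ∃ t ∈ T, d s t ≤ r) (hTS : ∀ t ∈ T, ∃ s ∈ S, d s t ≤ r) :
    hausdorffDistWrt d S T ≤ r := by
  refine max_le (Real.iSup_le (fun s => ?_) hr) (Real.iSup_le (fun t => ?_) hr)
  · obtain ⟨t, ht, h⟩ := hST s s.2
    exact (ciInf_le ⟨0, by rintro _ ⟨t, rfl⟩; exact hd _ _⟩ (⟨t, ht⟩ : T)).trans h
  · obtain ⟨s, hs, h⟩ := hTS t t.2
    exact (ciInf_le ⟨0, by rintro _ ⟨s, rfl⟩; exact hd _ _⟩ (⟨s, hs⟩ : S)).trans h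

lemma AdmissibleMetric.nonneg {X Y : Type*} [MetricSpace X] [MetricSpace Y]
    (δ : AdmissibleMetric X Y) (p q : X ⊕ Y) : 0 ≤ δ.d p q := by
  by_cases h : p = q
  · rw [h, δ.refl]
  · exact (δ.pos p q h).le

lemma pairGHDist_le {X Y : Type*} [MetricSpace X] [MetricSpace Y] (δ : AdmissibleMetric X Y)
    (A : Set X) (B : Set Y) : pairGHDist A B ≤ pairHausdorffDist δ A B := by
  refine csInf_le ⟨0, ?_⟩ ⟨δ, rfl⟩
  rintro _ ⟨δ', rfl⟩
  exact add_nonneg (hausdorffDistWrt_nonneg δ'.nonneg _ _) (hausdorffDistWrt_nonneg δ'.nonneg _ _)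

/-- The admissible metric obtained by gluing `X` and `Y` along two maps from a common space,
under which corresponding points end up at distance `η`. -/
noncomputable def AdmissibleMetric.glue {X Y Z : Type*} [MetricSpace X] [MetricSpace Y]
    [Nonempty Z] (Φ : Z → X) (Ψ : Z → Y) (η : ℝ) (hη : 0 < η)
    (H : ∀ p q, |dist (Φ p) (Φ q) - dist (Ψ p) (Ψ q)| ≤ 2 * η) : AdmissibleMetric X Y :=
  letI := glueMetricApprox Φ Ψ η hη H
  { d := fun p q => dist p q
    refl := dist_self
    pos := fun _ _ h => dist_pos.2 h
    symm := dist_comm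
    triangle := dist_triangle
    restr_left := fun _ _ => rfl
    restr_right := fun _ _ => rfl }

lemma AdmissibleMetric.glue_apply_glued {X Y Z : Type*} [MetricSpace X] [MetricSpace Y]
    [Nonempty Z] (Φ : Z → X) (Ψ : Z → Y) (η : ℝ) (hη : 0 < η)
    (H : ∀ p q, |dist (Φ p) (Φ q) - dist (Ψ p) (Ψ q)| ≤ 2 * η) (z : Z) :
    (AdmissibleMetric.glue Φ Ψ η hη H).d (.inl (Φ z)) (.inr (Ψ z)) = η :=
  glueDist_glued_points Φ Ψ η z

/-- A map `f : Y → X` which distorts distances by at most `2 * η`, whose image is an `r`-net of `X`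
and which maps `f ⁻¹' A` onto an `r`-net of `A`, bounds the Gromov–Hausdorff distance. -/
lemma pairGHDist_preimage_le {X Y : Type*} [MetricSpace X] [MetricSpace Y] [Nonempty Y]
    (f : Y → X) (A : Set X) {η r : ℝ} (hη : 0 < η) (hr : 0 ≤ r)
    (H : ∀ p q, |dist (f p) (f q) - dist p q| ≤ 2 * η)
    (hX : ∀ x, ∃ y, dist x (f y) ≤ r) (hA : ∀ a ∈ A, ∃ y, f y ∈ A ∧ dist a (f y) ≤ r) :
    pairGHDist A (f ⁻¹' A) ≤ 2 * (r + η) := by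
  let δ := AdmissibleMetric.glue f id η hη H
  have hglued (y : Y) : δ.d (.inl (f y)) (.inr y) = η :=
    AdmissibleMetric.glue_apply_glued f id η hη H y
  have hnear {x : X} {y : Y} (h : dist x (f y) ≤ r) : δ.d (.inl x) (.inr y) ≤ r + η := by
    have := δ.triangle (.inl x) (.inl (f y)) (.inr y)
    rw [δ.restr_left, hglued] at this
    linarith
  have hrη : 0 ≤ r + η := by positivity
  refine (pairGHDist_le δ _ _).trans ((add_le_add
    (hausdorffDistWrt_le δ.nonneg hrη ?_ ?_)
    (hausdorffDistWrt_le δ.nonneg hrη ?_ ?_)).trans (two_mul _).ge)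
  · rintro _ ⟨x, rfl⟩
    obtain ⟨y, hy⟩ := hX x
    exact ⟨_, ⟨y, rfl⟩, hnear hy⟩
  · rintro _ ⟨y, rfl⟩
    exact ⟨_, ⟨f y, rfl⟩, by rw [hglued]; linarith⟩
  · rintro _ ⟨a, ha, rfl⟩
    obtain ⟨y, hyA, hy⟩ := hA a ha
    exact ⟨_, ⟨y, hyA, rfl⟩, hnear hy⟩
  · rintro _ ⟨y, hy, rfl⟩
    exact ⟨_, ⟨f y, hy, rfl⟩, by rw [hglued]; linarith⟩

lemma exists_countable_forall_exists_dist_lt {ι α : Type*} [PseudoMetricSpace α]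
    [SecondCountableTopology α] (F : ι → α) :
    ∃ C : Set ι, C.Countable ∧ ∀ i, ∀ ε > 0, ∃ c ∈ C, dist (F i) (F c) < ε := by
  let : PseudoMetricSpace ι := .induced F ‹_›
  have : SecondCountableTopology ι := 
    (Topology.IsInducing.mk rfl : Topology.IsInducing F).secondCountableTopology
  obtain ⟨C, hC, hdense⟩ := TopologicalSpace.exists_countable_dense ι
  exact ⟨C, hC, fun i ε hε => hdense.exists_dist_lt i hε⟩

/-- A compact set `A` in a compact metric space admits a finite net of the whole space
containing a net of `A`. -/
lemma exists_finset_net {X : Type*} [MetricSpace X] [CompactSpace X] {A : Set X}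
    (hA : IsClosed A) {r : ℝ} (hr : 0 < r) :
    ∃ T : Finset X, (∀ x, ∃ t ∈ T, dist x t ≤ r) ∧ ∀ a ∈ A, ∃ t ∈ T, t ∈ A ∧ dist a t ≤ r := by
  classical
  obtain ⟨s, -, hs, hsX⟩ := (isCompact_univ (X := X)).finite_cover_balls hr
  obtain ⟨t, htA, ht, hAt⟩ := hA.isCompact.finite_cover_balls hr
  refine ⟨hs.toFinset ∪ ht.toFinset, fun x => ?_, fun a ha => ?_⟩
  · obtain ⟨y, hy, hxy⟩ := mem_iUnion₂.1 (hsX (mem_univ x))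
    exact ⟨y, by simp [hy], (mem_ball.1 hxy).le⟩
  · obtain ⟨y, hy, hay⟩ := mem_iUnion₂.1 (hAt ha)
    exact ⟨y, by simp [hy], htA hy, (mem_ball.1 hay).le⟩

/-- The compact metric pair on `Fin n` given by a metric and a nonempty subset. -/
def MetricPair.ofFin {n : ℕ} (m : MetricSpace (Fin n)) (S : {S : Set (Fin n) // S.Nonempty}) :
    MetricPair where
  carrier := Fin n
  m := m
  cpt := inferInstance
  A := S
  hne := S.2
  hcl := @Set.Finite.isClosed _ m.toUniformSpace.toTopologicalSpace inferInstance _ S.1.toFinite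

/-- The metric space `(GH₁, d_GH)` of (isometry classes of) compact metric
pairs, equipped with the Gromov–Hausdorff distance for metric pairs, is separable: there is a
countable family of compact metric pairs which is `d_GH`-dense among all compact metric pairs. -/
theorem metricPair_separable :
    ∃ D : Set MetricPair, D.Countable ∧
      ∀ P : MetricPair, ∀ ε : ℝ, 0 < ε → ∃ Q ∈ D, MetricPair.ghDist P Q < ε := by
  choose C hC hCdense using fun n : ℕ =>
    exists_countable_forall_exists_dist_lt
      (fun (m : MetricSpace (Fin n)) (i j : Fin n) => m.dist i j)
  refine ⟨⋃ n, ⋃ S : {S : Set (Fin n) // S.Nonempty}, (MetricPair.ofFin · S) '' C n,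
    countable_iUnion fun n => countable_iUnion fun S => (hC n).image _, fun P ε hε => ?_⟩
  obtain ⟨T, hTX, hTA⟩ := exists_finset_net P.hcl (r := ε / 8) (by positivity)
  let e := T.equivFin
  let f : Fin T.card → P.carrier := fun i => e.symm i
  have hf : f.Injective := Subtype.val_injective.comp e.symm.injective
  have hfT {x : P.carrier} (hx : x ∈ T) : f (e ⟨x, hx⟩) = x := by simp [f]
  have hfX (x : P.carrier) : ∃ i, dist x (f i) ≤ ε / 8 := by
    obtain ⟨t, ht, h⟩ := hTX x
    exact ⟨e ⟨t, ht⟩, by rwa [hfT]⟩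
  have hfA : ∀ a ∈ P.A, ∃ i, f i ∈ P.A ∧ dist a (f i) ≤ ε / 8 := by
    intro a ha
    obtain ⟨t, ht, htA, h⟩ := hTA a ha
    exact ⟨e ⟨t, ht⟩, by rwa [hfT], by rwa [hfT]⟩
  obtain ⟨a, ha⟩ := P.hne
  obtain ⟨i, hi, -⟩ := hfA a ha
  obtain ⟨m, hm, hdist⟩ := hCdense T.card (MetricSpace.induced f hf P.m) (ε / 8) (by positivity)
  refine ⟨MetricPair.ofFin m ⟨f ⁻¹' P.A, i, hi⟩,
    mem_iUnion₂.2 ⟨_, _, mem_image_of_mem _ hm⟩, ?_⟩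
  have : Nonempty (Fin T.card) := ⟨i⟩
  have H (p q : Fin T.card) : |dist (f p) (f q) - m.dist p q| ≤ 2 * (ε / 8) := by
    have := (dist_pi_lt_iff (by positivity)).1 ((dist_pi_lt_iff (by positivity)).1 hdist p) q
    exact (this.le : |dist (f p) (f q) - m.dist p q| ≤ ε / 8).trans (by linarith)
  refine (@pairGHDist_preimage_le _ _ P.m m _ f P.A _ _ (by positivity) (by positivity)
    H hfX hfA).trans_lt ?_
  linarith
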